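/- Let Γ be a geometric distance-regular graph with classical parameters (D, b, α, β) such that b ≥ 2, 1 ≤ α ≤ b−1 and D ≥ 3, with line set 𝓒, and let r = [D]. Assume that for every vertex x of Γ the local graph Δ_x is the α-clique extension of the (β/α) × r grid, and that β > αr. Then for every pair of vertices x, y at distance i (2 ≤ i ≤ D), the subgraph induced on C_i(x, y) = Γ_{i−1}(x) ∩ Γ(y) is an induced subgraph of the [i] × [i] grid. -/

import Mathlib

open SimpleGraph

namespace DRGPaper

variable {V : Type*}

/-- `Γ` is a distance-regular graph with diameter `D` and intersection arrays `cc`, `aa`, `bb`: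
`Γ` is connected of diameter `D` and for any vertices `x, y` at distance `i ≤ D`, `y` has exactly
`cc i` neighbours at distance `i - 1` from `x`, `aa i` neighbours at distance `i` from `x`,
and `bb i` neighbours at distance `i + 1` from `x`. -/
def IsDRG [Fintype V] (G : SimpleGraph V) (D : ℕ) (cc aa bb : ℕ → ℕ) : Prop :=
  G.Connected ∧
  (∀ x y : V, G.dist x y ≤ D) ∧
  (∃ x y : V, G.dist x y = D) ∧
  ∀ i : ℕ, i ≤ D → ∀ x y : V, G.dist x y = i →
    {z : V | G.Adj y z ∧ G.dist x z = i - 1}.ncard = cc i ∧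
    {z : V | G.Adj y z ∧ G.dist x z = i}.ncard = aa i ∧
    {z : V | G.Adj y z ∧ G.dist x z = i + 1}.ncard = bb i

/-- `[j] = (b^j - 1)/(b - 1) = 1 + b + ⋯ + b^(j-1)` as a real number. -/
def gauss (b j : ℕ) : ℝ := ∑ i ∈ Finset.range j, (b : ℝ) ^ i

/-- `Γ` has classical parameters `(D, b, α, β)`: it is distance-regular of diameter `D` with
`bb i = ([D] - [i])(β - α[i])` for `0 ≤ i ≤ D - 1` and `cc i = [i](1 + α[i-1])` for
`1 ≤ i ≤ D`. -/
def HasClassicalParams [Fintype V] (G : SimpleGraph V) (D b : ℕ) (α β : ℝ)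
    (cc aa bb : ℕ → ℕ) : Prop :=
  IsDRG G D cc aa bb ∧
  (∀ i : ℕ, i ≤ D - 1 → (bb i : ℝ) = (gauss b D - gauss b i) * (β - α * gauss b i)) ∧
  (∀ i : ℕ, 1 ≤ i → i ≤ D → (cc i : ℝ) = gauss b i * (1 + α * gauss b (i - 1)))

/-- `d(x, C) = min {d(x, y) : y ∈ C}`. -/
noncomputable def distToSet (G : SimpleGraph V) (x : V) (C : Set V) : ℕ :=
  sInf (G.dist x '' C)

/-- A maximal clique of `G`. -/
def IsMaxClique (G : SimpleGraph V) (s : Set V) : Prop :=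
  G.IsClique s ∧ ∀ t : Set V, G.IsClique t → s ⊆ t → t = s

/-- The lines for the PLS(γ) property: maximal cliques with at least `γ` vertices. -/
def plsLines (G : SimpleGraph V) (γ : ℕ) : Set (Set V) :=
  {ℓ : Set V | IsMaxClique G ℓ ∧ γ ≤ ℓ.ncard}

/-- `G` is the point graph of the partial linear space with line set `L`: any two adjacent
vertices lie on exactly one common line of `L`. -/
def IsPointGraphOf (G : SimpleGraph V) (L : Set (Set V)) : Prop :=
  ∀ x y : V, G.Adj x y → ∃! ℓ : Set V, ℓ ∈ L ∧ x ∈ ℓ ∧ y ∈ ℓ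

/-- A vertex is a Delsarte vertex (w.r.t. the line set `L` and classical parameter `β`) if all
lines through it have exactly `β + 1` vertices. -/
def IsDelsarteVertex (L : Set (Set V)) (β : ℝ) (x : V) : Prop :=
  ∀ ℓ ∈ L, x ∈ ℓ → (ℓ.ncard : ℝ) = β + 1

/-- The lines for the SPLS(c, s) property: maximal cliques with at least
`a1 + 2 - (c - 1)(s - 1)` vertices. -/
def splsLines (G : SimpleGraph V) (a1 c s : ℕ) : Set (Set V) :=
  {ℓ : Set V | IsMaxClique G ℓ ∧ (a1 : ℤ) + 2 - ((c : ℤ) - 1) * ((s : ℤ) - 1) ≤ (ℓ.ncard : ℤ)}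

/-- The SPLS(c, s) property: `G` is the point graph of the partial linear space whose lines are
the maximal cliques with at least `a1 + 2 - (c-1)(s-1)` vertices, `a1 ≥ (2s-1)(c-1)`, each
vertex lies on at most `s` lines, and every point not on a line `ℓ` is collinear with at most
`c` points of `ℓ`.  SPLS(s) is the case `c = c₂`. -/
def HasSPLS (G : SimpleGraph V) (a1 c s : ℕ) : Prop :=
  1 ≤ c ∧ 2 ≤ s ∧
  (2 * (s : ℤ) - 1) * ((c : ℤ) - 1) ≤ (a1 : ℤ) ∧
  IsPointGraphOf G (splsLines G a1 c s) ∧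
  (∀ x : V, {ℓ ∈ splsLines G a1 c s | x ∈ ℓ}.ncard ≤ s) ∧
  (∀ ℓ ∈ splsLines G a1 c s, ∀ x : V, x ∉ ℓ → {y ∈ ℓ | G.Adj x y}.ncard ≤ c)

/-- `[x, y]`: the set of lines `ℓ ∈ L` through `x` such that `d(y, u) ≤ 2` for all `u ∈ ℓ`. -/
def lineXY (G : SimpleGraph V) (L : Set (Set V)) (x y : V) : Set (Set V) :=
  {ℓ ∈ L | x ∈ ℓ ∧ ∀ u ∈ ℓ, G.dist y u ≤ 2}

/-- `𝓒` witnesses that `G` is geometric with cliques of order `q`: every member of `𝓒` is a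
clique with exactly `q` vertices and every edge of `G` lies in a unique member of `𝓒`. -/
def IsGeomLineSet (G : SimpleGraph V) (q : ℝ) (𝓒 : Set (Set V)) : Prop :=
  (∀ C ∈ 𝓒, G.IsClique C ∧ (C.ncard : ℝ) = q) ∧
  ∀ x y : V, G.Adj x y → ∃! C : Set V, C ∈ 𝓒 ∧ x ∈ C ∧ y ∈ C

/-- `G` is geometric: there is a set of Delsarte cliques (cliques of the maximum order `q`)
such that every edge lies in a unique member. -/
def IsGeometric (G : SimpleGraph V) (q : ℝ) : Prop :=
  ∃ 𝓒 : Set (Set V), IsGeomLineSet G q 𝓒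

/-- An assembly: a maximal clique which is not a line. -/
def IsAssembly (G : SimpleGraph V) (𝓒 : Set (Set V)) (M : Set V) : Prop :=
  IsMaxClique G M ∧ M ∉ 𝓒

/-- The dual Pasch axiom: for every pair of adjacent vertices `x, y`, the common neighbours of
`x` and `y` outside the (any) line of `𝓒` through `x` and `y` form a clique. -/
def DualPasch (G : SimpleGraph V) (𝓒 : Set (Set V)) : Prop :=
  ∀ x y : V, G.Adj x y → ∀ ℓ ∈ 𝓒, x ∈ ℓ → y ∈ ℓ →
    G.IsClique {z : V | G.Adj x z ∧ G.Adj y z ∧ z ∉ ℓ}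

/-- The `m × n` grid, i.e. the Cartesian product `K_m □ K_n`. -/
def gridGraph (m n : ℕ) : SimpleGraph (Fin m × Fin n) :=
  (⊤ : SimpleGraph (Fin m)).boxProd (⊤ : SimpleGraph (Fin n))

/-- The `A`-clique extension of a graph `H`: replace every vertex of `H` by a clique of size
`A`, vertices in distinct cliques being adjacent exactly when the underlying vertices of `H`
are adjacent. -/
def cliqueExt {W : Type*} (H : SimpleGraph W) (A : ℕ) : SimpleGraph (W × Fin A) :=
  SimpleGraph.fromRel (fun p q => H.Adj p.1 q.1 ∨ p.1 = q.1)

/-- `θ` is an eigenvalue of the adjacency matrix of `G`. -/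
def IsAdjEigenvalue [Fintype V] (G : SimpleGraph V) [DecidableRel G.Adj] (θ : ℝ) : Prop :=
  ∃ v : V → ℝ, v ≠ 0 ∧ (G.adjMatrix ℝ).mulVec v = θ • v

section Helpers

open scoped Classical

/-- Row and column coordinates on all local graphs of `G`, identifying each of them with the
`A`-clique extension of the `m × n` grid. -/
structure GridCoords [Fintype V] (G : SimpleGraph V) (m n A : ℕ) (p q : V → V → ℕ) : Prop where
  p_lt : ∀ x z, G.Adj x z → p x z < m
  q_lt : ∀ x z, G.Adj x z → q x z < n
  adj_iff : ∀ x z w, G.Adj x z → G.Adj x w → z ≠ w →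
    (G.Adj z w ↔ p x z = p x w ∨ q x z = q x w)
  card_cell : ∀ x, ∀ a < m, ∀ c < n,
    (Finset.univ.filter fun z => G.Adj x z ∧ p x z = a ∧ q x z = c).card = A

theorem cliqueExt_gridGraph_adj {m n A : ℕ} (u v : (Fin m × Fin n) × Fin A) :
    (cliqueExt (gridGraph m n) A).Adj u v ↔
      u ≠ v ∧ (u.1.1 = v.1.1 ∨ u.1.2 = v.1.2) := by
  obtain ⟨⟨a, c⟩, s⟩ := u
  obtain ⟨⟨a', c'⟩, s'⟩ := v
  simp only [cliqueExt, gridGraph, SimpleGraph.fromRel_adj, SimpleGraph.boxProd_adj,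
    SimpleGraph.top_adj, Prod.mk.injEq, ne_eq]
  grind

theorem exists_gridCoords [Fintype V] (G : SimpleGraph V) (m n A : ℕ)
    (hloc : ∀ x : V, Nonempty ((G.induce (G.neighborSet x)) ≃g cliqueExt (gridGraph m n) A)) :
    ∃ p q : V → V → ℕ, GridCoords G m n A p q := by
  let e := fun x => (hloc x).some
  refine ⟨fun x z => if h : G.Adj x z then ((e x ⟨z, h⟩).1.1 : ℕ) else 0,
    fun x z => if h : G.Adj x z then ((e x ⟨z, h⟩).1.2 : ℕ) else 0, ?_, ?_, ?_, ?_⟩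
  · intro x z hz
    simp [hz]
  · intro x z hz
    simp [hz]
  · intro x z w hz hw hne
    have h1 := (e x).map_adj_iff (v := ⟨z, hz⟩) (w := ⟨w, hw⟩)
    rw [cliqueExt_gridGraph_adj] at h1
    have h2 : e x ⟨z, hz⟩ ≠ e x ⟨w, hw⟩ := by
      intro h
      exact hne (congrArg Subtype.val ((e x).injective h))
    simp only [SimpleGraph.comap_adj, Function.Embedding.subtype_apply] at h1
    simp only [hz, hw, dif_pos, ← Fin.ext_iff, ← h1]
    tauto
  · intro x a ha c hc
    have hinj : Function.Injective
        (fun s : Fin A => ((e x).symm ((⟨a, ha⟩, ⟨c, hc⟩), s)).1) := by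
      intro s t hst
      have := (e x).symm.injective (Subtype.ext hst)
      simpa using this
    refine Eq.trans (congrArg Finset.card ?_)
      ((Finset.card_image_of_injective Finset.univ hinj).trans (Finset.card_fin A))
    ext z
    simp only [Finset.mem_filter, Finset.mem_univ, true_and, Finset.mem_image]
    constructor
    · rintro ⟨hz, h1, h2⟩
      simp only [hz, dif_pos] at h1 h2
      refine ⟨(e x ⟨z, hz⟩).2, ?_⟩
      have : (((⟨a, ha⟩, ⟨c, hc⟩), (e x ⟨z, hz⟩).2) : (Fin m × Fin n) × Fin A)
          = e x ⟨z, hz⟩ := by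
        ext <;> simp [h1, h2]
      rw [this]
      simp
    · rintro ⟨s, rfl⟩
      have hz : G.Adj x ((e x).symm ((⟨a, ha⟩, ⟨c, hc⟩), s)).1 :=
        ((e x).symm ((⟨a, ha⟩, ⟨c, hc⟩), s)).2
      have hs : e x ⟨_, hz⟩ = ((⟨a, ha⟩, ⟨c, hc⟩), s) := (e x).apply_symm_apply _
      simp only [hz, dif_pos, hs, and_self]

namespace GridCoords

variable [Fintype V] {G : SimpleGraph V} {m n A : ℕ} {p q : V → V → ℕ}

theorem swap (hc : GridCoords G m n A p q) : GridCoords G n m A q p where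
  p_lt := hc.q_lt
  q_lt := hc.p_lt
  adj_iff x z w hz hw hne := (hc.adj_iff x z w hz hw hne).trans or_comm
  card_cell x a ha c hc' := by
    rw [← hc.card_cell x c hc' a ha]
    congr 1
    ext z
    simp only [Finset.mem_filter]
    tauto

theorem card_cells (hc : GridCoords G m n A p q) (x : V) {a : ℕ} (ha : a < m)
    {B : Finset ℕ} (hB : B ⊆ Finset.range n) :
    (Finset.univ.filter fun z => G.Adj x z ∧ p x z = a ∧ q x z ∈ B).card = B.card * A := by
  rw [Finset.card_eq_sum_card_fiberwise (f := q x) (t := B)]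
  · rw [← smul_eq_mul, ← Finset.sum_const]
    refine Finset.sum_congr rfl fun c hcB => ?_
    rw [← hc.card_cell x a ha c (by simpa using hB hcB), Finset.filter_filter]
    congr 1
    ext z
    simp only [Finset.mem_filter]
    grind
  · intro z hz
    simpa using (Finset.mem_filter.1 hz).2.2.2

theorem card_column (hc : GridCoords G m n A p q) (x : V) {a : ℕ} (ha : a < m) :
    (Finset.univ.filter fun z => G.Adj x z ∧ p x z = a).card = n * A := by
  have := hc.card_cells x ha (B := Finset.range n) subset_rfl
  rw [Finset.card_range] at this
  rw [← this]
  congr 1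
  ext z
  simp only [Finset.mem_filter, Finset.mem_range]
  have := hc.q_lt x z
  tauto

theorem clique_coord (hc : GridCoords G m n A p q) (x : V) (s : Set V)
    (hs : G.IsClique s) (hx : ∀ z ∈ s, G.Adj x z) :
    (∀ u ∈ s, ∀ v ∈ s, p x u = p x v) ∨ (∀ u ∈ s, ∀ v ∈ s, q x u = q x v) := by
  have key : ∀ u ∈ s, ∀ v ∈ s, p x u = p x v ∨ q x u = q x v := by
    intro u hu v hv
    by_cases h : u = v
    · exact Or.inl (by rw [h])
    · exact (hc.adj_iff x u v (hx u hu) (hx v hv) h).1 (hs hu hv h)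
  grind

/-- The members of a geometric line set are the rows of the local coordinates. -/
theorem mem_line_iff (hc : GridCoords G m n A p q) {𝓒 : Set (Set V)} {β : ℝ}
    (hgeo : IsGeomLineSet G (β + 1) 𝓒) (hβ : β = m * A) (hlt : n * A < m * A)
    {C : Set V} (hC : C ∈ 𝓒) {x z : V} (hx : x ∈ C) (hz : z ∈ C) (hxz : G.Adj x z) (w : V) :
    w ∈ C ↔ w = x ∨ (G.Adj x w ∧ q x w = q x z) := by
  obtain ⟨hcl, hcard⟩ := hgeo.1 C hC
  have hadj : ∀ w ∈ C \ {x}, G.Adj x w := fun w hw => hcl hx hw.1 (Ne.symm hw.2)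
  have hncard : (C \ {x}).ncard = m * A := by
    have h1 := Set.ncard_sdiff_singleton_add_one hx
    rw [← h1, hβ] at hcard
    push_cast at hcard
    exact_mod_cast (add_right_cancel hcard)
  have hzx : z ∈ C \ {x} := ⟨hz, hxz.ne'⟩
  have hq : ∀ u ∈ C \ {x}, q x u = q x z := by
    rcases hc.clique_coord x (C \ {x}) (hcl.subset Set.sdiff_subset) hadj with h | h
    · exfalso
      have h1 : C \ {x} ⊆ ↑(Finset.univ.filter fun w => G.Adj x w ∧ p x w = p x z) := by
        intro u hu
        simpa using ⟨hadj u hu, h u hu z hzx⟩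
      have h2 := Set.ncard_le_ncard h1
      rw [Set.ncard_coe_finset, hc.card_column x (hc.p_lt x z hxz), hncard] at h2
      omega
    · exact fun u hu => h u hu z hzx
  have h1 : C \ {x} ⊆ ↑(Finset.univ.filter fun w => G.Adj x w ∧ q x w = q x z) := by
    intro u hu
    simpa using ⟨hadj u hu, hq u hu⟩
  have h2 := Set.eq_of_subset_of_ncard_le h1 (by
    rw [Set.ncard_coe_finset, hc.swap.card_column x (hc.q_lt x z hxz), hncard])
  have h3 : w ∈ C \ {x} ↔ G.Adj x w ∧ q x w = q x z := by rw [h2]; simp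
  rw [← h3]
  by_cases hw : w = x
  · simp [hw, hx]
  · simp [hw]

theorem q_symm (hc : GridCoords G m n A p q) {𝓒 : Set (Set V)} {β : ℝ}
    (hgeo : IsGeomLineSet G (β + 1) 𝓒) (hβ : β = m * A) (hlt : n * A < m * A)
    {x z w : V} (hxz : G.Adj x z) (hxw : G.Adj x w) (hwz : w ≠ z) (h : q x w = q x z) :
    q z w = q z x := by
  obtain ⟨C, ⟨hC, hx, hz⟩, -⟩ := hgeo.2 x z hxz
  have hw := (hc.mem_line_iff hgeo hβ hlt hC hx hz hxz w).2 (Or.inr ⟨hxw, h⟩)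
  have := (hc.mem_line_iff hgeo hβ hlt hC hz hx hxz.symm w).1 hw
  tauto

theorem p_symm (hc : GridCoords G m n A p q) {𝓒 : Set (Set V)} {β : ℝ}
    (hgeo : IsGeomLineSet G (β + 1) 𝓒) (hβ : β = m * A) (hlt : n * A < m * A) (hn : 2 ≤ n)
    {x z w : V} (hxz : G.Adj x z) (hxw : G.Adj x w) (hwz : w ≠ z) (h : p x w = p x z) :
    p z w = p z x := by
  have hA : 0 < A := by
    rcases Nat.eq_zero_or_pos A with h | h
    · simp [h] at hlt
    · exact h
  have off : ∀ v, G.Adj x v → p x v = p x z → q x v ≠ q x z →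
      G.Adj z v ∧ p z v = p z x ∧ q z v ≠ q z x := by
    intro v hxv hp hq
    have hvz : v ≠ z := by rintro rfl; exact hq rfl
    have hzv : G.Adj z v := (hc.adj_iff x z v hxz hxv hvz.symm).2 (Or.inl hp.symm)
    have hq' : q z v ≠ q z x := fun h' =>
      hq (hc.q_symm hgeo hβ hlt hxz.symm hzv hxv.ne' h')
    refine ⟨hzv, ?_, hq'⟩
    have := (hc.adj_iff z v x hzv hxz.symm hxv.ne').1 hxv.symm
    tauto
  by_cases hq : q x w = q x z
  · obtain ⟨c, hcn, hcq⟩ : ∃ c < n, c ≠ q x z := by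
      by_cases h0 : q x z = 0
      · exact ⟨1, by omega, by omega⟩
      · exact ⟨0, by omega, by omega⟩
    have hpos := hc.card_cell x _ (hc.p_lt x z hxz) c hcn
    obtain ⟨v, hv⟩ := Finset.card_pos.1 (hpos ▸ hA)
    obtain ⟨hxv, hpv, hqv⟩ := (Finset.mem_filter.1 hv).2
    obtain ⟨hzv, hp1, hq1⟩ := off v hxv hpv (by rw [hqv]; exact hcq)
    have hvw : v ≠ w := by rintro rfl; exact hcq (hqv ▸ hq)
    have hadj : G.Adj v w := (hc.adj_iff x v w hxv hxw hvw).2 (Or.inl (hpv.trans h.symm))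
    have hzw : G.Adj z w := (hc.adj_iff x z w hxz hxw hwz.symm).2 (Or.inl h.symm)
    have hqw := hc.q_symm hgeo hβ hlt hxz hxw hwz hq
    rcases (hc.adj_iff z v w hzv hzw hvw).1 hadj with h' | h'
    · exact h'.symm.trans hp1
    · exact absurd (h'.trans hqw) hq1
  · exact (off w hxw h hq).2.1

end GridCoords

/-- In a geometric graph with `n` lines on every vertex, an eigenvector for the eigenvalue `-n`
sums to zero on every line. -/
theorem sum_line_eq_zero [Fintype V] {G : SimpleGraph V} {𝓒 : Set (Set V)} {β : ℝ} (hβ : 0 < β)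
    (n : ℕ) (hgeo : IsGeomLineSet G (β + 1) 𝓒)
    (hdeg : ∀ y, ((Finset.univ.filter (G.Adj y)).card : ℝ) = n * β) (f : V → ℝ)
    (hf : ∀ y, ∑ z with G.Adj y z, f z = -n * f y) {C : Set V} (hC : C ∈ 𝓒) :
    ∑ z with z ∈ C, f z = 0 := by
  have hswap : ∀ (g : V → ℝ) (y : V),
      ∑ C with C ∈ 𝓒 ∧ y ∈ C, ∑ z with z ∈ C ∧ z ≠ y, g z = ∑ z with G.Adj y z, g z := by
    intro g y
    rw [Finset.sum_comm' (s' := fun z => Finset.univ.filter fun C => C ∈ 𝓒 ∧ y ∈ C ∧ z ∈ C)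
      (t' := Finset.univ.filter (G.Adj y))]
    · refine Finset.sum_congr rfl fun z hz => ?_
      obtain ⟨C, hC, huniq⟩ := hgeo.2 y z (by simpa using hz)
      have : (Finset.univ.filter fun C => C ∈ 𝓒 ∧ y ∈ C ∧ z ∈ C) = {C} := by
        ext C'
        simp only [Finset.mem_filter, Finset.mem_univ, true_and, Finset.mem_singleton]
        exact ⟨huniq C', fun h => h ▸ hC⟩
      rw [this, Finset.sum_singleton]
    · intro C z
      simp only [Finset.mem_filter, Finset.mem_univ, true_and]
      constructor
      · rintro ⟨⟨h1, h2⟩, h3, h4⟩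
        exact ⟨⟨h1, h2, h3⟩, (hgeo.1 C h1).1 h2 h3 (Ne.symm h4)⟩
      · rintro ⟨⟨h1, h2, h3⟩, h4⟩
        exact ⟨⟨h1, h2⟩, h3, h4.ne'⟩
  have hsplit : ∀ (g : V → ℝ) (C : Set V) (y : V), y ∈ C →
      ∑ z with z ∈ C, g z = g y + ∑ z with z ∈ C ∧ z ≠ y, g z := by
    intro g C y hy
    rw [← Finset.add_sum_erase _ g (a := y) (by simpa using hy)]
    congr 2
    ext z
    simp only [Finset.mem_filter, Finset.mem_erase]
    tauto
  have hlines : ∀ y, ((Finset.univ.filter fun C => C ∈ 𝓒 ∧ y ∈ C).card : ℝ) = n := by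
    intro y
    have h1 := hswap (fun _ => 1) y
    rw [Finset.sum_const, nsmul_eq_mul, mul_one, hdeg] at h1
    rw [Finset.sum_congr rfl (g := fun _ => β), Finset.sum_const, nsmul_eq_mul] at h1
    · exact mul_right_cancel₀ hβ.ne' h1
    · intro C hC
      obtain ⟨hC, hy⟩ := (Finset.mem_filter.1 hC).2
      have h2 := hsplit (fun _ => 1) C y hy
      have h3 := (hgeo.1 C hC).2
      rw [Finset.sum_const, nsmul_eq_mul, mul_one, ← Set.ncard_coe_finset] at h2
      simp only [Finset.coe_filter, Finset.mem_univ, true_and, Set.ofPred_mem_eq] at h2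
      linarith
  have hzero : ∀ y, ∑ C with C ∈ 𝓒 ∧ y ∈ C, ∑ z with z ∈ C, f z = 0 := by
    intro y
    rw [Finset.sum_congr rfl (g := fun C => f y + ∑ z with z ∈ C ∧ z ≠ y, f z),
      Finset.sum_add_distrib, hswap, hf, Finset.sum_const, nsmul_eq_mul, hlines]
    · ring
    · intro C hC
      exact hsplit f C y (Finset.mem_filter.1 hC).2.2
  have hsq : ∑ C with C ∈ 𝓒, (∑ z with z ∈ C, f z) ^ 2 = 0 := by
    have : ∀ C : Set V, (∑ z with z ∈ C, f z) ^ 2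
        = ∑ y with y ∈ C, f y * ∑ z with z ∈ C, f z := by
      intro C
      rw [sq, Finset.sum_mul]
    simp only [this]
    rw [Finset.sum_comm' (s' := fun y => Finset.univ.filter fun C => C ∈ 𝓒 ∧ y ∈ C)
      (t' := Finset.univ)]
    · refine Finset.sum_eq_zero fun y _ => ?_
      rw [← Finset.mul_sum, hzero, mul_zero]
    · intro C y
      simp
  have := (Finset.sum_eq_zero_iff_of_nonneg (fun C _ => sq_nonneg _)).1 hsq C (by simpa using hC)
  simpa using this

theorem gauss_eq_cast (b j : ℕ) : gauss b j = ((∑ i ∈ Finset.range j, b ^ i : ℕ) : ℝ) := by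
  simp [gauss]

theorem gauss_nonneg (b j : ℕ) : 0 ≤ gauss b j := by
  rw [gauss_eq_cast]; positivity

theorem gauss_mono (b : ℕ) {i j : ℕ} (h : i ≤ j) : gauss b i ≤ gauss b j := by
  refine Finset.sum_le_sum_of_subset_of_nonneg (Finset.range_mono h) fun _ _ _ => by positivity

/-- The standard sequence of the eigenvalue `-[D]` of a graph with classical parameters. -/
noncomputable def stdSeq (b : ℕ) (α β : ℝ) : ℕ → ℝ
  | 0 => 1
  | i + 1 => stdSeq b α β i * (-(1 + α * gauss b i) / (β - α * gauss b i))

theorem dist_le_succ_of_adj {G : SimpleGraph V} (hG : G.Connected) (x : V) {y z : V}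
    (h : G.Adj y z) : G.dist x z ≤ G.dist x y + 1 := by
  have h1 := hG.dist_triangle (u := x) (v := y) (w := z)
  rwa [SimpleGraph.dist_eq_one_iff_adj.2 h] at h1

section ClassicalParams

variable [Fintype V] {G : SimpleGraph V} {D b : ℕ} {α β : ℝ} {cc aa bb : ℕ → ℕ}

theorem stdSeq_succ_mul {i : ℕ} (h : 0 < β - α * gauss b i) :
    stdSeq b α β (i + 1) * (β - α * gauss b i) = -stdSeq b α β i * (1 + α * gauss b i) := by
  rw [stdSeq]
  field_simp

theorem stdSeq_ne_zero (hα : 0 ≤ α) (hβα : α * gauss b D < β) {i : ℕ} (hi : i ≤ D) :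
    stdSeq b α β i ≠ 0 := by
  induction i with
  | zero => simp [stdSeq]
  | succ i ih =>
    have h1 : 0 < β - α * gauss b i := by
      have := mul_le_mul_of_nonneg_left (gauss_mono b (i := i) (j := D) (by omega)) hα
      linarith
    have h2 : 0 < 1 + α * gauss b i := by
      have := mul_nonneg hα (gauss_nonneg b i)
      linarith
    exact mul_ne_zero (ih (by omega)) (div_ne_zero (neg_ne_zero.2 h2.ne') h1.ne')

theorem HasClassicalParams.degree_eq (h : HasClassicalParams G D b α β cc aa bb) (hD : 1 ≤ D)
    (y : V) : ((Finset.univ.filter (G.Adj y)).card : ℝ) = gauss b D * β := by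
  obtain ⟨⟨hconn, -, -, harr⟩, hbb, -⟩ := h
  have h0 := (harr 0 (by omega) y y (by simp)).2.2
  have h1 := hbb 0 (by omega)
  simp only [gauss, Finset.range_zero, Finset.sum_empty, sub_zero, mul_zero] at h1
  rw [gauss, ← h1, ← h0, ← Set.ncard_coe_finset]
  congr 2
  ext z
  simp only [Finset.coe_filter, Finset.mem_univ, true_and, Set.mem_ofPred_eq, zero_add]
  rw [SimpleGraph.dist_eq_one_iff_adj]
  tauto

theorem HasClassicalParams.sum_stdSeq (h : HasClassicalParams G D b α β cc aa bb) (hD : 1 ≤ D)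
    (hα : 0 ≤ α) (hβα : α * gauss b D < β) (x y : V) :
    ∑ z with G.Adj y z, stdSeq b α β (G.dist x z) = -gauss b D * stdSeq b α β (G.dist x y) := by
  have hdeg := h.degree_eq hD y
  obtain ⟨⟨hconn, hdiam, -, harr⟩, hbb, hcc⟩ := h
  have hpos : ∀ i ≤ D, 0 < β - α * gauss b i := by
    intro i hi
    have := mul_le_mul_of_nonneg_left (gauss_mono b hi) hα
    linarith
  obtain ⟨j, hj⟩ : ∃ j, G.dist x y = j := ⟨_, rfl⟩
  have hjD : j ≤ D := hj ▸ hdiam x y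
  obtain ⟨h1, h2, h3⟩ := harr j hjD x y hj
  have hbbj : (bb j : ℝ) = (gauss b D - gauss b j) * (β - α * gauss b j) := by
    rcases Nat.lt_or_ge j D with hlt | hge
    · exact hbb j (by omega)
    · have : j = D := le_antisymm hjD hge
      subst this
      have : {z : V | G.Adj y z ∧ G.dist x z = j + 1} = ∅ := by
        ext z
        have := hdiam x z
        simp only [Set.mem_ofPred_eq, Set.mem_empty_iff_false, iff_false]
        omega
      rw [this, Set.ncard_empty] at h3
      rw [← h3]
      simp
  have hcard : ∀ i k, {z : V | G.Adj y z ∧ G.dist x z = i}.ncard = k →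
      (Finset.univ.filter fun z => G.Adj y z ∧ G.dist x z = i).card = k := by
    intro i k hk
    rw [← hk, ← Set.ncard_coe_finset]
    simp
  have hsum : ∀ i k, {z : V | G.Adj y z ∧ G.dist x z = i}.ncard = k → ∀ g : ℕ → ℝ,
      ∑ z with G.Adj y z ∧ G.dist x z = i, g (G.dist x z) = k * g i := by
    intro i k hk g
    rw [Finset.sum_congr rfl (g := fun _ => g i), Finset.sum_const, nsmul_eq_mul, hcard i k hk]
    intro z hz
    rw [(Finset.mem_filter.1 hz).2.2]
  rcases Nat.eq_zero_or_pos j with rfl | hj0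
  · have hxy : x = y := (hconn.dist_eq_zero_iff).1 hj
    subst hxy
    have hset : (Finset.univ.filter (G.Adj x)) =
        Finset.univ.filter fun z => G.Adj x z ∧ G.dist x z = 0 + 1 := by
      ext z
      simp only [Finset.mem_filter, Finset.mem_univ, true_and, zero_add]
      rw [SimpleGraph.dist_eq_one_iff_adj]
      tauto
    rw [hset, hsum _ _ h3, hbbj, hj]
    have := stdSeq_succ_mul (hpos 0 (by omega))
    simp only [gauss, Finset.range_zero, Finset.sum_empty, sub_zero, mul_zero, add_zero,
      mul_one] at this ⊢
    linear_combination (∑ i ∈ Finset.range D, (b : ℝ) ^ i) * this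
  · have hsplit : ∀ g : ℕ → ℝ, ∑ z with G.Adj y z, g (G.dist x z)
        = cc j * g (j - 1) + aa j * g j + bb j * g (j + 1) := by
      intro g
      rw [← hsum _ _ h1 g, ← hsum _ _ h2 g, ← hsum _ _ h3 g, ← Finset.sum_union,
        ← Finset.sum_union]
      · refine Finset.sum_congr ?_ fun _ _ => rfl
        ext z
        simp only [Finset.mem_filter, Finset.mem_univ, true_and, Finset.mem_union]
        constructor
        · intro hz
          have e1 := dist_le_succ_of_adj hconn x hz
          have e2 := dist_le_succ_of_adj hconn x hz.symm
          have : G.dist x z = j - 1 ∨ G.dist x z = j ∨ G.dist x z = j + 1 := by omega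
          tauto
        · tauto
      · rw [Finset.disjoint_left]
        intro z hz hz'
        simp only [Finset.mem_filter, Finset.mem_univ, true_and, Finset.mem_union] at hz hz'
        omega
      · rw [Finset.disjoint_left]
        intro z hz hz'
        simp only [Finset.mem_filter, Finset.mem_univ, true_and] at hz hz'
        omega
    have hone := hsplit (fun _ => 1)
    rw [Finset.sum_const, nsmul_eq_mul, hdeg] at hone
    rw [hsplit, hj]
    obtain ⟨i, rfl⟩ : ∃ i, j = i + 1 := ⟨j - 1, by omega⟩
    have hccj := hcc (i + 1) (by omega) hjD
    simp only [Nat.add_sub_cancel] at *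
    have e1 := stdSeq_succ_mul (hpos i (by omega))
    have e2 := stdSeq_succ_mul (hpos (i + 1) hjD)
    rw [hbbj, hccj] at hone ⊢
    linear_combination gauss b (i + 1) * e1 + (gauss b D - gauss b (i + 1)) * e2
      - stdSeq b α β (i + 1) * hone

/-- A line at distance `i < D` from `x` has exactly `1 + α[i]` points at distance `i`. -/
theorem HasClassicalParams.card_line_dist (h : HasClassicalParams G D b α β cc aa bb)
    {𝓒 : Set (Set V)} (hgeo : IsGeomLineSet G (β + 1) 𝓒)
    (hα : 0 ≤ α) (hβα : α * gauss b D < β) {n : ℕ} (hn : (n : ℝ) = gauss b D)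
    {C : Set V} (hC : C ∈ 𝓒) {x z : V} {i : ℕ} (hi : i + 1 ≤ D) (hz : z ∈ C)
    (hxz : G.dist x z = i) (hge : ∀ u ∈ C, i ≤ G.dist x u) :
    ((Finset.univ.filter fun u => u ∈ C ∧ G.dist x u = i).card : ℝ) = 1 + α * gauss b i := by
  have hconn := h.1.1
  have hβ : 0 < β := lt_of_le_of_lt (mul_nonneg hα (gauss_nonneg b D)) hβα
  have hzero := sum_line_eq_zero hβ n hgeo (fun y => by rw [hn]; exact h.degree_eq (by omega) y)
    (fun z => stdSeq b α β (G.dist x z))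
    (fun y => by rw [hn]; exact h.sum_stdSeq (by omega) hα hβα x y) hC
  obtain ⟨hcl, hcard⟩ := hgeo.1 C hC
  have hsplit : ∀ g : ℕ → ℝ, ∑ u with u ∈ C, g (G.dist x u) =
      (Finset.univ.filter fun u => u ∈ C ∧ G.dist x u = i).card * g i +
      (Finset.univ.filter fun u => u ∈ C ∧ G.dist x u = i + 1).card * g (i + 1) := by
    intro g
    rw [← nsmul_eq_mul, ← nsmul_eq_mul, ← Finset.sum_const, ← Finset.sum_const,
      ← Finset.sum_filter_add_sum_filter_not _ (fun u => G.dist x u = i), Finset.filter_filter,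
      Finset.filter_filter]
    congr 1
    · refine Finset.sum_congr rfl fun u hu => ?_
      rw [(Finset.mem_filter.1 hu).2.2]
    · have key : ∀ u ∈ C, ¬ G.dist x u = i ↔ G.dist x u = i + 1 := by
        intro u hu
        have h1 := hge u hu
        have h2 : G.dist x u ≤ i + 1 := by
          by_cases huz : z = u
          · subst huz; omega
          · have := dist_le_succ_of_adj hconn x (hcl hz hu huz)
            omega
        omega
      refine Finset.sum_congr ?_ fun u hu => ?_
      · ext u
        simp only [Finset.mem_filter, Finset.mem_univ, true_and]
        have := key u
        tauto
      · rw [(Finset.mem_filter.1 hu).2.2]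
  have hone := hsplit (fun _ => 1)
  rw [hsplit] at hzero
  rw [Finset.sum_const, nsmul_eq_mul, mul_one, ← Set.ncard_coe_finset] at hone
  simp only [Finset.coe_filter, Finset.mem_univ, true_and, Set.ofPred_mem_eq, hcard,
    mul_one] at hone
  have hpos : 0 < β - α * gauss b i := by
    have := mul_le_mul_of_nonneg_left (gauss_mono b (i := i) (j := D) (by omega)) hα
    linarith
  have e := stdSeq_succ_mul hpos
  have hne : stdSeq b α β i * (β + 1) ≠ 0 :=
    mul_ne_zero (stdSeq_ne_zero hα hβα (by omega)) (by linarith)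
  apply mul_left_cancel₀ hne
  generalize ((Finset.univ.filter fun u => u ∈ C ∧ G.dist x u = i).card : ℝ) = s at *
  generalize ((Finset.univ.filter fun u => u ∈ C ∧ G.dist x u = i + 1).card : ℝ) = t at *
  have ht : t = β + 1 - s := by linarith
  subst ht
  linear_combination (β - α * gauss b i) * hzero - (β + 1 - s) * e

end ClassicalParams

/-- The distance counts on the rows of the local graphs from which the local structure of the
sets `Γ_i(x) ∩ Γ(y)` is derived. -/
structure LocalGridGeom [Fintype V] (G : SimpleGraph V) (D : ℕ) (g : ℕ → ℕ) (m n A : ℕ)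
    (p q : V → V → ℕ) : Prop where
  coords : GridCoords G m n A p q
  conn : G.Connected
  g_one : g 1 = 1
  q_symm : ∀ x z w, G.Adj x z → G.Adj x w → w ≠ z → q x w = q x z → q z w = q z x
  p_symm : ∀ x z w, G.Adj x z → G.Adj x w → w ≠ z → p x w = p x z → p z w = p z x
  card_row_far : ∀ x y z i, i + 1 ≤ D → G.dist x y = i + 1 → G.Adj y z → G.dist x z = i →
    (Finset.univ.filter fun u => G.Adj y u ∧ q y u = q y z ∧ G.dist x u = i).card = 1 + A * g i
  card_row_near : ∀ x z w i, i + 1 ≤ D → G.dist x z = i → G.Adj z w →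
    (∀ u, G.Adj z u → q z u = q z w → i ≤ G.dist x u) →
    (Finset.univ.filter fun u => G.Adj z u ∧ q z u = q z w ∧ G.dist x u = i).card = A * g i
  card_near : ∀ x y i, i + 1 ≤ D → G.dist x y = i + 1 →
    (Finset.univ.filter fun z => G.Adj y z ∧ G.dist x z = i).card = g (i + 1) * (1 + A * g i)

/-- The neighbours of `y` at distance `i` from `x`. -/
noncomputable def nearSet [Fintype V] (G : SimpleGraph V) (x y : V) (i : ℕ) : Finset V :=
  Finset.univ.filter fun z => G.Adj y z ∧ G.dist x z = i

namespace LocalGridGeom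

variable [Fintype V] {G : SimpleGraph V} {D : ℕ} {g : ℕ → ℕ} {m n A : ℕ} {p q : V → V → ℕ}

theorem mem_nearSet {x y z : V} {i : ℕ} : z ∈ nearSet G x y i ↔ G.Adj y z ∧ G.dist x z = i := by
  simp [nearSet]

theorem card_image_of_fiber {x y : V} {i : ℕ} (H : LocalGridGeom G D g m n A p q)
    (hi : i + 1 ≤ D) (hxy : G.dist x y = i + 1) (f : V → ℕ)
    (hf : ∀ z ∈ nearSet G x y i,
      ((nearSet G x y i).filter fun w => f w = f z).card = 1 + A * g i) :
    ((nearSet G x y i).image f).card = g (i + 1) := by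
  have h1 := Finset.card_eq_sum_card_image f (nearSet G x y i)
  rw [Finset.sum_congr rfl (g := fun _ => 1 + A * g i), Finset.sum_const, smul_eq_mul] at h1
  · have h2 : (nearSet G x y i).card = _ := H.card_near x y i hi hxy
    rw [h2] at h1
    exact (Nat.eq_of_mul_eq_mul_right (by omega) h1).symm
  · intro c hc
    obtain ⟨z, hz, rfl⟩ := Finset.mem_image.1 hc
    exact hf z hz

theorem card_image_q {x y : V} {i : ℕ} (H : LocalGridGeom G D g m n A p q)
    (hi : i + 1 ≤ D) (hxy : G.dist x y = i + 1) :
    ((nearSet G x y i).image (q y)).card = g (i + 1) := by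
  refine H.card_image_of_fiber hi hxy _ fun z hz => ?_
  obtain ⟨hyz, hxz⟩ := mem_nearSet.1 hz
  rw [← H.card_row_far x y z i hi hxy hyz hxz]
  congr 1
  ext w
  simp only [Finset.mem_filter, Finset.mem_univ, true_and, mem_nearSet]
  tauto

theorem dist_le_of_coord_eq {x z u v : V} {i : ℕ} (H : LocalGridGeom G D g m n A p q)
    (hv : v ∈ nearSet G x z i) (hu : G.Adj z u) (h : p z u = p z v ∨ q z u = q z v) :
    G.dist x u ≤ i + 1 := by
  obtain ⟨hzv, hxv⟩ := mem_nearSet.1 hv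
  by_cases huv : v = u
  · subst huv; omega
  · have hadj : G.Adj v u := (H.coords.adj_iff z v u hzv hu huv).2 (by tauto)
    have := dist_le_succ_of_adj H.conn x hadj
    omega

/-- On a line through `z` all of whose points are at least as far from `x` as `z`, every point
as far as `z` lies in a column through `z` containing a point closer to `x`. -/
theorem p_mem_image {x z w : V} {i : ℕ} (H : LocalGridGeom G D g m n A p q)
    (hi : i + 2 ≤ D) (hxz : G.dist x z = i + 1)
    (hP : ((nearSet G x z i).image (p z)).card = g (i + 1)) (hzw : G.Adj z w)
    (hrow : ∀ u, G.Adj z u → q z u = q z w → i + 1 ≤ G.dist x u) (hxw : G.dist x w = i + 1) :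
    p z w ∈ (nearSet G x z i).image (p z) := by
  have hB : (nearSet G x z i).image (p z) ⊆ Finset.range m := by
    intro a ha
    obtain ⟨v, hv, rfl⟩ := Finset.mem_image.1 ha
    exact Finset.mem_range.2 (H.coords.p_lt z v (mem_nearSet.1 hv).1)
  have h1 := H.coords.swap.card_cells z (H.coords.q_lt z w hzw) hB
  have h2 := H.card_row_near x z w (i + 1) hi hxz hzw hrow
  have hsub : (Finset.univ.filter fun u => G.Adj z u ∧ q z u = q z w ∧
        p z u ∈ (nearSet G x z i).image (p z)) ⊆
      Finset.univ.filter fun u => G.Adj z u ∧ q z u = q z w ∧ G.dist x u = i + 1 := by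
    intro u hu
    obtain ⟨hzu, hq, hp⟩ := (Finset.mem_filter.1 hu).2
    obtain ⟨v, hv, hvu⟩ := Finset.mem_image.1 hp
    refine Finset.mem_filter.2 ⟨Finset.mem_univ _, hzu, hq, le_antisymm ?_ (hrow u hzu hq)⟩
    exact H.dist_le_of_coord_eq hv hzu (Or.inl hvu.symm)
  have heq := Finset.eq_of_subset_of_card_le hsub (by rw [h1, h2, hP, mul_comm])
  have hw : w ∈ Finset.univ.filter fun u => G.Adj z u ∧ q z u = q z w ∧ G.dist x u = i + 1 := by
    simp [hzw, hxw]
  rw [← heq] at hw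
  exact (Finset.mem_filter.1 hw).2.2.2

theorem p_notMem_image {x y z : V} {i : ℕ} (H : LocalGridGeom G D g m n A p q)
    (hxy : G.dist x y = i + 2) (hzy : G.Adj z y) :
    p z y ∉ (nearSet G x z i).image (p z) := by
  intro hmem
  obtain ⟨v, hv, hvy⟩ := Finset.mem_image.1 hmem
  have := H.dist_le_of_coord_eq hv hzy (Or.inl hvy.symm)
  omega

theorem card_image_p {i : ℕ} (H : LocalGridGeom G D g m n A p q) :
    ∀ {x y : V}, i + 1 ≤ D → G.dist x y = i + 1 →
      ((nearSet G x y i).image (p y)).card = g (i + 1) := by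
  induction i with
  | zero =>
    intro x y hi hxy
    have : nearSet G x y 0 = {x} := by
      ext z
      rw [mem_nearSet, Finset.mem_singleton, H.conn.dist_eq_zero_iff]
      constructor
      · exact fun h => h.2.symm
      · rintro rfl
        exact ⟨(SimpleGraph.dist_eq_one_iff_adj.1 hxy).symm, rfl⟩
    rw [this]
    simp [H.g_one]
  | succ i ih =>
    intro x y hi hxy
    refine H.card_image_of_fiber hi hxy _ fun z hz => ?_
    obtain ⟨hyz, hxz⟩ := mem_nearSet.1 hz
    have hP := ih (x := x) (y := z) (by omega) hxz
    have hB : (nearSet G x z i).image (q z) ⊆ Finset.range n := by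
      intro a ha
      obtain ⟨v, hv, rfl⟩ := Finset.mem_image.1 ha
      exact Finset.mem_range.2 (H.coords.q_lt z v (mem_nearSet.1 hv).1)
    have hcells := H.coords.card_cells z (H.coords.p_lt z y hyz.symm) hB
    rw [H.card_image_q (by omega) hxz] at hcells
    have hset : ((nearSet G x y (i + 1)).filter fun w => p y w = p y z) =
        insert z (Finset.univ.filter fun u => G.Adj z u ∧ p z u = p z y ∧
          q z u ∈ (nearSet G x z i).image (q z)) := by
      ext w
      simp only [Finset.mem_filter, Finset.mem_univ, true_and, Finset.mem_insert, mem_nearSet]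
      by_cases hwz : w = z
      · subst hwz
        simp [hyz, hxz]
      · simp only [hwz, false_or]
        constructor
        · rintro ⟨⟨hyw, hxw⟩, hp⟩
          have hzw : G.Adj z w :=
            (H.coords.adj_iff y z w hyz hyw (Ne.symm hwz)).2 (Or.inl hp.symm)
          have hp' := H.p_symm y z w hyz hyw hwz hp
          refine ⟨hzw, hp', ?_⟩
          by_contra hq
          refine H.p_notMem_image hxy hyz.symm
            (hp' ▸ H.p_mem_image (w := w) hi hxz hP hzw ?_ hxw)
          intro u hzu hqu
          have h1 := dist_le_succ_of_adj H.conn x hzu.symm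
          by_contra hlt
          exact hq (hqu ▸ Finset.mem_image_of_mem _ (mem_nearSet.2 ⟨hzu, by omega⟩))
        · rintro ⟨hzw, hp, hq⟩
          obtain ⟨v, hv, hvw⟩ := Finset.mem_image.1 hq
          have hle := H.dist_le_of_coord_eq hv hzw (Or.inr hvw.symm)
          have hwy : w ≠ y := by rintro rfl; omega
          have hyw : G.Adj y w := (H.coords.adj_iff z y w hyz.symm hzw hwy.symm).2
            (Or.inl hp.symm)
          have h1 := dist_le_succ_of_adj H.conn x hyw.symm
          exact ⟨⟨hyw, by omega⟩, H.p_symm z y w hyz.symm hzw hwy hp⟩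
    rw [hset, Finset.card_insert_of_notMem (by simp), hcells, mul_comm, add_comm]

theorem cell_injective {x y z w : V} {i : ℕ} (H : LocalGridGeom G D g m n A p q)
    (hi : i + 2 ≤ D) (hxy : G.dist x y = i + 2) (hz : z ∈ nearSet G x y (i + 1))
    (hw : w ∈ nearSet G x y (i + 1)) (hp : p y z = p y w) (hq : q y z = q y w) : z = w := by
  by_contra hne
  obtain ⟨hyz, hxz⟩ := mem_nearSet.1 hz
  obtain ⟨hyw, hxw⟩ := mem_nearSet.1 hw
  have hzw : G.Adj z w := (H.coords.adj_iff y z w hyz hyw hne).2 (Or.inl hp)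
  have hp' := H.p_symm y z w hyz hyw (Ne.symm hne) hp.symm
  have hq' := H.q_symm y z w hyz hyw (Ne.symm hne) hq.symm
  refine H.p_notMem_image hxy hyz.symm (hp' ▸
    H.p_mem_image (w := w) hi hxz (H.card_image_p (by omega) hxz) hzw ?_ hxw)
  intro u hzu hqu
  by_cases huy : u = y
  · subst huy; omega
  · have hadj : G.Adj u y :=
      (H.coords.adj_iff z u y hzu hyz.symm huy).2 (Or.inr (hqu.trans hq'))
    have := dist_le_succ_of_adj H.conn x hadj
    omega

theorem nonempty_embedding {x y : V} {i : ℕ} (H : LocalGridGeom G D g m n A p q)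
    (hi : i + 2 ≤ D) (hxy : G.dist x y = i + 2) :
    Nonempty ((G.induce {z : V | G.dist x z = i + 1 ∧ G.Adj y z}) ↪g
      gridGraph (g (i + 2)) (g (i + 2))) := by
  let ep := Finset.equivFinOfCardEq (H.card_image_p (i := i + 1) hi hxy)
  let eq := Finset.equivFinOfCardEq (H.card_image_q (i := i + 1) hi hxy)
  have hmem : ∀ z : {z : V | G.dist x z = i + 1 ∧ G.Adj y z}, z.1 ∈ nearSet G x y (i + 1) :=
    fun z => mem_nearSet.2 ⟨z.2.2, z.2.1⟩
  let F : {z : V | G.dist x z = i + 1 ∧ G.Adj y z} → Fin (g (i + 2)) × Fin (g (i + 2)) :=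
    fun z => (ep ⟨p y z, Finset.mem_image_of_mem _ (hmem z)⟩,
      eq ⟨q y z, Finset.mem_image_of_mem _ (hmem z)⟩)
  have hF1 : ∀ z w, (F z).1 = (F w).1 ↔ p y z = p y w := by intro z w; simp [F]
  have hF2 : ∀ z w, (F z).2 = (F w).2 ↔ q y z = q y w := by intro z w; simp [F]
  have hinj : ∀ z w : {z : V | G.dist x z = i + 1 ∧ G.Adj y z}, p y z = p y w →
      q y z = q y w → z = w := fun z w h1 h2 =>
    Subtype.ext (H.cell_injective hi hxy (hmem z) (hmem w) h1 h2)
  refine ⟨⟨⟨F, fun z w h => hinj z w ((hF1 z w).1 (congrArg Prod.fst h))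
    ((hF2 z w).1 (congrArg Prod.snd h))⟩, ?_⟩⟩
  intro z w
  change (gridGraph _ _).Adj (F z) (F w) ↔ G.Adj z.1 w.1
  simp only [gridGraph, SimpleGraph.boxProd_adj, SimpleGraph.top_adj, ne_eq, hF1, hF2]
  by_cases hzw : z = w
  · subst hzw; simp
  · rw [H.coords.adj_iff y z.1 w.1 z.2.2 w.2.2 (fun h => hzw (Subtype.ext h))]
    have := hinj z w
    tauto

end LocalGridGeom

theorem HasClassicalParams.localGridGeom [Fintype V] {G : SimpleGraph V} {D b : ℕ} {α β : ℝ}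
    {cc aa bb : ℕ → ℕ} (h : HasClassicalParams G D b α β cc aa bb) {𝓒 : Set (Set V)}
    (hgeo : IsGeomLineSet G (β + 1) 𝓒) {A m n : ℕ} (hA : (A : ℝ) = α) (hβ : β = m * A)
    (hn : (n : ℝ) = gauss b D) (hn2 : 2 ≤ n) (hβα : α * gauss b D < β) {p q : V → V → ℕ}
    (hc : GridCoords G m n A p q) :
    LocalGridGeom G D (fun j => ∑ i ∈ Finset.range j, b ^ i) m n A p q := by
  have hα : 0 ≤ α := hA ▸ Nat.cast_nonneg A
  have hlt : n * A < m * A := by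
    rw [hβ, ← hn, ← hA, mul_comm] at hβα
    exact_mod_cast hβα
  have hconn := h.1.1
  refine ⟨hc, hconn, by simp, fun x z w => hc.q_symm hgeo hβ hlt,
    fun x z w => hc.p_symm hgeo hβ hlt hn2, ?_, ?_, ?_⟩
  · intro x y z i hi hxy hyz hxz
    obtain ⟨C, ⟨hC, hyC, hzC⟩, -⟩ := hgeo.2 y z hyz
    have hcl := (hgeo.1 C hC).1
    have hcard := h.card_line_dist hgeo hα hβα hn hC hi hzC hxz (fun u hu => by
      by_cases huy : u = y
      · subst huy; omega
      · have := dist_le_succ_of_adj hconn x (hcl hu hyC huy)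
        omega)
    rw [gauss_eq_cast, ← hA] at hcard
    have hcard' : (Finset.univ.filter fun u => u ∈ C ∧ G.dist x u = i).card =
      1 + A * ∑ i ∈ Finset.range i, b ^ i := by exact_mod_cast hcard
    rw [← hcard']
    congr 1
    ext u
    simp only [Finset.mem_filter, Finset.mem_univ, true_and,
      hc.mem_line_iff hgeo hβ hlt hC hyC hzC hyz u]
    by_cases huy : u = y
    · subst huy
      simp [hxy]
    · tauto
  · intro x z w i hi hxz hzw hrow
    obtain ⟨C, ⟨hC, hzC, hwC⟩, -⟩ := hgeo.2 z w hzw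
    have hline := hc.mem_line_iff hgeo hβ hlt hC hzC hwC hzw
    have hcard := h.card_line_dist hgeo hα hβα hn hC hi hzC hxz (fun u hu => by
      rcases (hline u).1 hu with rfl | ⟨h1, h2⟩
      · exact hxz.ge
      · exact hrow u h1 h2)
    rw [gauss_eq_cast, ← hA] at hcard
    have hcard' : (Finset.univ.filter fun u => u ∈ C ∧ G.dist x u = i).card =
      1 + A * ∑ i ∈ Finset.range i, b ^ i := by exact_mod_cast hcard
    have hset : (Finset.univ.filter fun u => u ∈ C ∧ G.dist x u = i) =
        insert z (Finset.univ.filter fun u => G.Adj z u ∧ q z u = q z w ∧ G.dist x u = i) := by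
      ext u
      simp only [Finset.mem_filter, Finset.mem_univ, true_and, hline u, Finset.mem_insert]
      by_cases huz : u = z
      · subst huz
        simp [hxz]
      · tauto
    rw [hset, Finset.card_insert_of_notMem (by simp)] at hcard'
    omega
  · intro x y i hi hxy
    have h1 := (h.1.2.2.2 (i + 1) hi x y hxy).1
    have h2 := h.2.2 (i + 1) (by omega) hi
    rw [Nat.add_sub_cancel, gauss_eq_cast, gauss_eq_cast, ← hA, ← h1] at h2
    rw [← Set.ncard_coe_finset]
    simp only [Finset.coe_filter, Finset.mem_univ, true_and]
    exact_mod_cast h2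

end Helpers

/-- for a geometric distance-regular graph with classical parameters
`(D, b, α, β)`, `b ≥ 2`, `1 ≤ α ≤ b - 1`, `D ≥ 3`, line set `𝓒` and `r = [D]`, whose local
graphs are all the `α`-clique extension of the `(β/α) × r` grid, and with `β > αr`: for
vertices `x, y` at distance `i` (`2 ≤ i ≤ D`), the subgraph induced on
`C_i(x, y) = Γ_{i-1}(x) ∩ Γ(y)` is an induced subgraph of the `[i] × [i]` grid. -/
theorem statement_18 {V : Type*} [Fintype V] (G : SimpleGraph V) (D b : ℕ) (α β : ℝ)
    (cc aa bb : ℕ → ℕ) (hb : 2 ≤ b) (hD : 3 ≤ D)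
    (hα : 1 ≤ α ∧ α ≤ (b : ℝ) - 1)
    (h : HasClassicalParams G D b α β cc aa bb)
    (𝓒 : Set (Set V)) (hgeo : IsGeomLineSet G (β + 1) 𝓒)
    (A m n : ℕ) (hA : (A : ℝ) = α) (hm : (m : ℝ) = β / α) (hn : (n : ℝ) = gauss b D)
    (hloc : ∀ x : V, Nonempty ((G.induce (G.neighborSet x)) ≃g cliqueExt (gridGraph m n) A))
    (hβα : α * gauss b D < β) :
    ∀ x y : V, ∀ i : ℕ, 2 ≤ i → i ≤ D → G.dist x y = i →
      ∃ g : ℕ, (g : ℝ) = gauss b i ∧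
        Nonempty ((G.induce {z : V | G.dist x z = i - 1 ∧ G.Adj y z}) ↪g gridGraph g g) := by
  intro x y i hi hiD hxy
  have hα0 : 0 < α := by linarith [hα.1]
  have hβ : β = m * A := by
    rw [hm, hA]
    field_simp
  have hn2 : 2 ≤ n := by
    have h1 : gauss b 2 ≤ gauss b D := gauss_mono b (by omega)
    have h2 : gauss b 2 = 1 + b := by simp [gauss, Finset.sum_range_succ]
    have h3 : (2 : ℝ) ≤ b := by exact_mod_cast hb
    have : (2 : ℝ) ≤ n := by rw [hn]; linarith
    exact_mod_cast this
  obtain ⟨p, q, hc⟩ := exists_gridCoords G m n A hloc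
  have H := h.localGridGeom hgeo hA hβ hn hn2 hβα hc
  obtain ⟨j, rfl⟩ : ∃ j, i = j + 2 := ⟨i - 2, by omega⟩
  exact ⟨_, (gauss_eq_cast b (j + 2)).symm, H.nonempty_embedding hiD hxy⟩
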